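/- arXiv:1901.05873 — 6 statements merged into one kernel-verified Lean document; each statement's English description precedes it below -/
import Mathlib

section
/- Let Q be a quadratic form on a real vector space, let k ≥ 2 be a natural number, and let a, b be vectors with Q a = 1, Q b = 1 and QuadraticMap.polar Q a b = 2 * Real.cos (π / k) (i.e. the mirrors a and b meet at angle π/k). Then in CliffordAlgebra Q the rotor ι a * ι b satisfies (ι a * ι b)^k = -1, and hence (ι a * ι b)^(2k) = 1, so the group generated by the two reflections closes up after 2k steps (the kaleidoscope property). -/
theorem rotor_aux {A : Type*} [Ring A] [Algebra ℝ A] (R : A) (t : ℝ)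
    (h : R * R = (2 * Real.cos t) • R - 1) (n : ℕ) :
    Real.sin t • R ^ (n + 1) = Real.sin ((n + 1 : ℝ) * t) • R - Real.sin (n * t) • (1 : A) := by
  induction n with
  | zero => simp
  | succ n ih =>
    have e : Real.sin (((n + 1 : ℕ) + 1 : ℝ) * t)
        = 2 * Real.cos t * Real.sin ((n + 1 : ℝ) * t) - Real.sin (n * t) := by
      have h1 : ((n + 1 : ℕ) + 1 : ℝ) * t = (n + 1 : ℝ) * t + t := by push_cast; ring
      have h2 : (n : ℝ) * t = (n + 1 : ℝ) * t - t := by ring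
      rw [h1, h2, Real.sin_add, Real.sin_sub]; ring
    rw [pow_succ, ← smul_mul_assoc, ih, sub_mul, smul_mul_assoc, h, e]
    push_cast
    simp only [smul_mul_assoc, one_mul]
    module

theorem kaleidoscope_rotor_pow
    {V : Type*} [AddCommGroup V] [Module ℝ V] (Q : QuadraticForm ℝ V)
    (k : ℕ) (hk : 2 ≤ k) (a b : V) (ha : Q a = 1) (hb : Q b = 1)
    (hab : QuadraticMap.polar Q a b = 2 * Real.cos (Real.pi / k)) :
    (CliffordAlgebra.ι Q a * CliffordAlgebra.ι Q b) ^ k = -1 ∧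
      (CliffordAlgebra.ι Q a * CliffordAlgebra.ι Q b) ^ (2 * k) = 1 := by
  have hR : (CliffordAlgebra.ι Q a * CliffordAlgebra.ι Q b) *
      (CliffordAlgebra.ι Q a * CliffordAlgebra.ι Q b) =
      (2 * Real.cos (Real.pi / k)) • (CliffordAlgebra.ι Q a * CliffordAlgebra.ι Q b) - 1 := by
    rw [← mul_assoc, CliffordAlgebra.ι_mul_ι_mul_ι, ha, hab, one_smul, map_sub, map_smul, sub_mul,
      CliffordAlgebra.ι_sq_scalar, hb, map_one, smul_mul_assoc]
  have hk2 : (2 : ℝ) ≤ k := by exact_mod_cast hk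
  have hs : Real.sin (Real.pi / k) ≠ 0 := by
    apply ne_of_gt
    apply Real.sin_pos_of_pos_of_lt_pi
    · have := Real.pi_pos
      positivity
    · exact div_lt_self Real.pi_pos (by linarith)
  have main : (CliffordAlgebra.ι Q a * CliffordAlgebra.ι Q b) ^ k = -1 := by
    have h := rotor_aux _ _ hR (k - 1)
    rw [Nat.sub_add_cancel (by omega), Nat.cast_sub (by omega)] at h
    have h1 : (((k : ℝ) - (1 : ℕ)) + 1) * (Real.pi / k) = Real.pi := by
      push_cast; field_simp; ring
    have h2 : ((k : ℝ) - (1 : ℕ)) * (Real.pi / k) = Real.pi - Real.pi / k := by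
      push_cast; field_simp
    rw [h1, h2, Real.sin_pi, Real.sin_pi_sub, zero_smul, zero_sub, ← smul_neg] at h
    exact smul_right_injective _ hs h
  refine ⟨main, ?_⟩
  rw [mul_comm, pow_mul, main]
  simp
end

section
/- In Cl(2,0,1), every normalized euclidean point squares to -1: for all x, y : ℝ, (E₀ + x • E₁ + y • E₂) * (E₀ + x • E₁ + y • E₂) = algebraMap ℝ (CliffordAlgebra Q) (-1). -/
noncomputable section

/-- The standard basis vectors of `Fin 3 → ℝ`. -/
def e (i : Fin 3) : Fin 3 → ℝ := Pi.single i 1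

/-- The basis 2-vector `E₀ = ι e₁ * ι e₂` (the origin). -/
def E₀ (Q : QuadraticForm ℝ (Fin 3 → ℝ)) : CliffordAlgebra Q :=
  CliffordAlgebra.ι Q (e 1) * CliffordAlgebra.ι Q (e 2)

/-- The basis 2-vector `E₁ = ι e₂ * ι e₀` (the ideal point in the x-direction). -/
def E₁ (Q : QuadraticForm ℝ (Fin 3 → ℝ)) : CliffordAlgebra Q :=
  CliffordAlgebra.ι Q (e 2) * CliffordAlgebra.ι Q (e 0)

/-- The basis 2-vector `E₂ = ι e₀ * ι e₁` (the ideal point in the y-direction). -/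
def E₂ (Q : QuadraticForm ℝ (Fin 3 → ℝ)) : CliffordAlgebra Q :=
  CliffordAlgebra.ι Q (e 0) * CliffordAlgebra.ι Q (e 1)

theorem pga_aux {A : Type*} [Ring A] [Algebra ℝ A] (a b c : A) (x y : ℝ)
    (aa : a * a = 0) (bb : b * b = 1) (cc : c * c = 1)
    (ba : b * a = -(a * b)) (ca : c * a = -(a * c)) (cb : c * b = -(b * c)) :
    (b * c + x • (c * a) + y • (a * b)) * (b * c + x • (c * a) + y • (a * b)) = -1 := by
  have aa' : ∀ z, a * (a * z) = 0 := fun z => by rw [← mul_assoc, aa, zero_mul]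
  have bb' : ∀ z, b * (b * z) = z := fun z => by rw [← mul_assoc, bb, one_mul]
  have cc' : ∀ z, c * (c * z) = z := fun z => by rw [← mul_assoc, cc, one_mul]
  have ba' : ∀ z, b * (a * z) = -(a * (b * z)) := fun z => by
    rw [← mul_assoc, ba, neg_mul, mul_assoc]
  have ca' : ∀ z, c * (a * z) = -(a * (c * z)) := fun z => by
    rw [← mul_assoc, ca, neg_mul, mul_assoc]
  have cb' : ∀ z, c * (b * z) = -(b * (c * z)) := fun z => by
    rw [← mul_assoc, cb, neg_mul, mul_assoc]
  simp only [mul_add, add_mul, smul_mul_assoc, mul_smul_comm, mul_assoc, aa, bb, cc, ba, ca, cb,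
    aa', bb', cc', ba', ca', cb', mul_neg, neg_mul, neg_neg, mul_zero, neg_zero, smul_zero,
    mul_one, smul_neg]
  module

theorem normalized_point_sq_eq_neg_one
    (Q : QuadraticForm ℝ (Fin 3 → ℝ))
    (hQ : ∀ c : Fin 3 → ℝ, Q c = (c 1) ^ 2 + (c 2) ^ 2) (x y : ℝ) :
    (E₀ Q + x • E₁ Q + y • E₂ Q) * (E₀ Q + x • E₁ Q + y • E₂ Q) =
      algebraMap ℝ (CliffordAlgebra Q) (-1) := by
  have sq : ∀ i, CliffordAlgebra.ι Q (e i) * CliffordAlgebra.ι Q (e i)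
      = algebraMap ℝ _ (Q (e i)) := fun i => CliffordAlgebra.ι_sq_scalar Q (e i)
  have anti : ∀ i j, i ≠ j → CliffordAlgebra.ι Q (e i) * CliffordAlgebra.ι Q (e j)
      = -(CliffordAlgebra.ι Q (e j) * CliffordAlgebra.ι Q (e i)) := by
    intro i j hij
    rw [eq_neg_iff_add_eq_zero, CliffordAlgebra.ι_mul_ι_add_swap]
    have : QuadraticMap.polar Q (e i) (e j) = 0 := by
      simp only [QuadraticMap.polar, hQ, e]
      fin_cases i <;> fin_cases j <;> simp at hij ⊢
    rw [this, map_zero]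
  rw [map_neg, map_one]
  refine pga_aux _ _ _ x y ?_ ?_ ?_ (anti 1 0 (by decide)) (anti 2 0 (by decide))
    (anti 2 1 (by decide))
  · rw [sq, hQ]; simp [e]
  · rw [sq, hQ]; simp [e]
  · rw [sq, hQ]; simp [e]
end
end

section
/- In Cl(2,0,1), the grade-2 part of the product of two normalized euclidean points is an ideal point whose ideal norm equals the euclidean distance between them: for all x₁, y₁, x₂, y₂ : ℝ, with P = E₀ + x₁ • E₁ + y₁ • E₂ and Q' = E₀ + x₂ • E₁ + y₂ • E₂ one has P * Q' - Q' * P = (2 * (y₂ - y₁)) • E₁ + (2 * (x₁ - x₂)) • E₂, and the coefficients c₁ = 2(y₂ - y₁), c₂ = 2(x₁ - x₂) satisfy c₁^2 + c₂^2 = 4 * ((x₁ - x₂)^2 + (y₁ - y₂)^2). -/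
noncomputable section

theorem grade_two_part_of_product_of_points
    (Q : QuadraticForm ℝ (Fin 3 → ℝ))
    (hQ : ∀ c : Fin 3 → ℝ, Q c = (c 1) ^ 2 + (c 2) ^ 2) (x₁ y₁ x₂ y₂ : ℝ) :
    ((E₀ Q + x₁ • E₁ Q + y₁ • E₂ Q) * (E₀ Q + x₂ • E₁ Q + y₂ • E₂ Q) -
        (E₀ Q + x₂ • E₁ Q + y₂ • E₂ Q) * (E₀ Q + x₁ • E₁ Q + y₁ • E₂ Q) =
      (2 * (y₂ - y₁)) • E₁ Q + (2 * (x₁ - x₂)) • E₂ Q) ∧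
    (2 * (y₂ - y₁)) ^ 2 + (2 * (x₁ - x₂)) ^ 2 =
      4 * ((x₁ - x₂) ^ 2 + (y₁ - y₂) ^ 2) := by
  refine ⟨?_, by ring⟩
  have sq : ∀ i, CliffordAlgebra.ι Q (e i) * CliffordAlgebra.ι Q (e i)
      = algebraMap ℝ _ (Q (e i)) := fun i => CliffordAlgebra.ι_sq_scalar Q (e i)
  have h0 := sq 0
  have h1 := sq 1
  have h2 := sq 2
  have sw : ∀ i j, i ≠ j → CliffordAlgebra.ι Q (e i) * CliffordAlgebra.ι Q (e j)
      = - (CliffordAlgebra.ι Q (e j) * CliffordAlgebra.ι Q (e i)) := by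
    intro i j hij
    have h := CliffordAlgebra.ι_mul_ι_add_swap (Q := Q) (e i) (e j)
    have hp : QuadraticMap.polar Q (e i) (e j) = 0 := by
      simp only [QuadraticMap.polar, hQ, e]
      fin_cases i <;> fin_cases j <;> simp at hij ⊢
    rw [hp, map_zero] at h
    exact eq_neg_of_add_eq_zero_left h
  have s10 := sw 1 0 (by decide)
  have s20 := sw 2 0 (by decide)
  have s21 := sw 2 1 (by decide)
  have q0 : Q (e 0) = 0 := by rw [hQ]; simp [e]
  have q1 : Q (e 1) = 1 := by rw [hQ]; simp [e]
  have q2 : Q (e 2) = 1 := by rw [hQ]; simp [e]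
  rw [q0, map_zero] at h0
  rw [q1, map_one] at h1
  rw [q2, map_one] at h2
  clear sq sw q0 q1 q2
  simp only [E₀, E₁, E₂]
  generalize CliffordAlgebra.ι Q (e 0) = a at *
  generalize CliffordAlgebra.ι Q (e 1) = b at *
  generalize CliffordAlgebra.ι Q (e 2) = c at *
  have h0' : ∀ z, a * (a * z) = 0 := fun z => by rw [← mul_assoc, h0, zero_mul]
  have h1' : ∀ z, b * (b * z) = z := fun z => by rw [← mul_assoc, h1, one_mul]
  have h2' : ∀ z, c * (c * z) = z := fun z => by rw [← mul_assoc, h2, one_mul]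
  have s10' : ∀ z, b * (a * z) = -(a * (b * z)) := fun z => by
    rw [← mul_assoc, s10, neg_mul, mul_assoc]
  have s20' : ∀ z, c * (a * z) = -(a * (c * z)) := fun z => by
    rw [← mul_assoc, s20, neg_mul, mul_assoc]
  have s21' : ∀ z, c * (b * z) = -(b * (c * z)) := fun z => by
    rw [← mul_assoc, s21, neg_mul, mul_assoc]
  simp only [mul_add, add_mul, smul_mul_assoc, mul_smul_comm, mul_assoc, h0, h1, h2, h0', h1', h2',
    s10, s20, s21, s10', s20', s21', mul_neg, neg_mul, neg_neg, mul_one, mul_zero, smul_zero,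
    neg_zero]
  module
end
end

section
/- In Cl(2,0,1), the translator sandwich translates a euclidean point: for all x, y, c : ℝ, with T = 1 + c • E₁ (whose reverse is 1 - c • E₁) and P = E₀ + x • E₁ + y • E₂, one has (1 + c • E₁) * (E₀ + x • E₁ + y • E₂) * (1 - c • E₁) = E₀ + x • E₁ + (y + 2*c) • E₂; that is, T P T̃ translates the point (x, y) by 2c in the direction perpendicular to the ideal point E₁. -/
noncomputable section

theorem translator_sandwich_translates_point
    (Q : QuadraticForm ℝ (Fin 3 → ℝ))
    (hQ : ∀ c : Fin 3 → ℝ, Q c = (c 1) ^ 2 + (c 2) ^ 2) (x y c : ℝ) :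
    (1 + c • E₁ Q) * (E₀ Q + x • E₁ Q + y • E₂ Q) * (1 - c • E₁ Q) =
      E₀ Q + x • E₁ Q + (y + 2 * c) • E₂ Q := by
  have sq : ∀ i, CliffordAlgebra.ι Q (e i) * CliffordAlgebra.ι Q (e i)
      = algebraMap ℝ _ (Q (e i)) := fun i => CliffordAlgebra.ι_sq_scalar Q (e i)
  have ac : ∀ i j, i ≠ j → CliffordAlgebra.ι Q (e i) * CliffordAlgebra.ι Q (e j)
      = - (CliffordAlgebra.ι Q (e j) * CliffordAlgebra.ι Q (e i)) := by
    intro i j hij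
    rw [eq_neg_iff_add_eq_zero, CliffordAlgebra.ι_mul_ι_add_swap]
    have : QuadraticMap.polar Q (e i) (e j) = 0 := by
      simp only [QuadraticMap.polar, hQ, e]
      fin_cases i <;> fin_cases j <;> simp at hij ⊢
    rw [this, map_zero]
  have s0 := sq 0
  have s2 := sq 2
  have a20 := ac 2 0 (by decide)
  have a21 := ac 2 1 (by decide)
  have a10 := ac 1 0 (by decide)
  have q0 : Q (e 0) = 0 := by simp [hQ, e]
  have q2 : Q (e 2) = 1 := by simp [hQ, e]
  rw [q0, map_zero] at s0
  rw [q2, map_one] at s2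
  have h10 : E₁ Q * E₀ Q = E₂ Q := by
    unfold E₀ E₁ E₂
    generalize CliffordAlgebra.ι Q (e 0) = u at *
    generalize CliffordAlgebra.ι Q (e 1) = v at *
    generalize CliffordAlgebra.ι Q (e 2) = w at *
    calc w * u * (v * w) = (w * u) * v * w := by noncomm_ring
      _ = - (u * (w * v) * w) := by rw [a20]; noncomm_ring
      _ = u * v * (w * w) := by rw [a21]; noncomm_ring
      _ = u * v := by rw [s2, mul_one]
  have h01 : E₀ Q * E₁ Q = - E₂ Q := by
    unfold E₀ E₁ E₂
    generalize CliffordAlgebra.ι Q (e 0) = u at *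
    generalize CliffordAlgebra.ι Q (e 1) = v at *
    generalize CliffordAlgebra.ι Q (e 2) = w at *
    calc v * w * (w * u) = v * (w * w) * u := by noncomm_ring
      _ = - (u * v) := by rw [s2, mul_one, a10]
  have h11 : E₁ Q * E₁ Q = 0 := by
    unfold E₁
    generalize CliffordAlgebra.ι Q (e 0) = u at *
    generalize CliffordAlgebra.ι Q (e 2) = w at *
    calc w * u * (w * u) = w * u * (-(u * w)) := by rw [← a20]
      _ = -(w * (u * u) * w) := by noncomm_ring
      _ = 0 := by rw [s0]; simp
  have h12 : E₁ Q * E₂ Q = 0 := by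
    unfold E₁ E₂
    generalize CliffordAlgebra.ι Q (e 0) = u at *
    generalize CliffordAlgebra.ι Q (e 1) = v at *
    generalize CliffordAlgebra.ι Q (e 2) = w at *
    calc w * u * (u * v) = w * (u * u) * v := by noncomm_ring
      _ = 0 := by rw [s0]; simp
  have h21 : E₂ Q * E₁ Q = 0 := by
    rw [← h10, mul_assoc, h01, mul_neg, h12, neg_zero]
  simp only [mul_add, add_mul, mul_sub, one_mul, mul_one, smul_mul_assoc, mul_smul_comm,
    h10, h01, h11, h12, h21, smul_zero, add_zero, zero_mul, smul_neg]
  module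
end
end

section
/- In Cl(2,0,1), the rotor sandwich with R = cos α + sin α · E₀ rotates euclidean points about the origin by the angle 2α: for all x, y, α : ℝ, (Real.cos α • 1 + Real.sin α • E₀) * (E₀ + x • E₁ + y • E₂) * (Real.cos α • 1 - Real.sin α • E₀) = E₀ + (x * Real.cos (2*α) + y * Real.sin (2*α)) • E₁ + (- x * Real.sin (2*α) + y * Real.cos (2*α)) • E₂, where Real.cos α • 1 - Real.sin α • E₀ is the reverse of R. -/
noncomputable section

theorem rotor_sandwich_rotates_point
    (Q : QuadraticForm ℝ (Fin 3 → ℝ))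
    (hQ : ∀ c : Fin 3 → ℝ, Q c = (c 1) ^ 2 + (c 2) ^ 2) (x y α : ℝ) :
    (Real.cos α • (1 : CliffordAlgebra Q) + Real.sin α • E₀ Q) *
        (E₀ Q + x • E₁ Q + y • E₂ Q) *
        (Real.cos α • (1 : CliffordAlgebra Q) - Real.sin α • E₀ Q) =
      E₀ Q + (x * Real.cos (2 * α) + y * Real.sin (2 * α)) • E₁ Q +
        (- x * Real.sin (2 * α) + y * Real.cos (2 * α)) • E₂ Q := by
  have h1 : CliffordAlgebra.ι Q (e 1) * CliffordAlgebra.ι Q (e 1) = 1 := by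
    rw [CliffordAlgebra.ι_sq_scalar, hQ]; simp [e]
  have h2 : CliffordAlgebra.ι Q (e 2) * CliffordAlgebra.ι Q (e 2) = 1 := by
    rw [CliffordAlgebra.ι_sq_scalar, hQ]; simp [e]
  have anti : ∀ i j : Fin 3, i ≠ j → CliffordAlgebra.ι Q (e i) * CliffordAlgebra.ι Q (e j)
      = - (CliffordAlgebra.ι Q (e j) * CliffordAlgebra.ι Q (e i)) := by
    intro i j hij
    rw [eq_neg_iff_add_eq_zero, CliffordAlgebra.ι_mul_ι_add_swap, QuadraticMap.polar, hQ, hQ, hQ]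
    fin_cases i <;> fin_cases j <;> simp [e] at hij ⊢
  have h10 := anti 1 0 (by decide)
  have h20 := anti 2 0 (by decide)
  have h21 := anti 2 1 (by decide)
  have p00 : E₀ Q * E₀ Q = -1 := by
    unfold E₀
    generalize CliffordAlgebra.ι Q (e 0) = a at *
    generalize CliffordAlgebra.ι Q (e 1) = b at *
    generalize CliffordAlgebra.ι Q (e 2) = c at *
    calc b * c * (b * c) = b * (c * b) * c := by noncomm_ring
      _ = -((b * b) * (c * c)) := by rw [h21]; noncomm_ring
      _ = -1 := by rw [h1, h2, one_mul]
  have p01 : E₀ Q * E₁ Q = - E₂ Q := by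
    unfold E₀ E₁ E₂
    rw [← h10, mul_assoc, ← mul_assoc (CliffordAlgebra.ι Q (e 2)), h2, one_mul]
  have p20 : E₂ Q * E₀ Q = - E₁ Q := by
    unfold E₀ E₁ E₂
    rw [h20, neg_neg, mul_assoc, ← mul_assoc (CliffordAlgebra.ι Q (e 1)), h1, one_mul]
  have p02 : E₀ Q * E₂ Q = E₁ Q := by
    have : E₁ Q = - (E₂ Q * E₀ Q) := by rw [p20, neg_neg]
    unfold E₀ E₁ E₂
    generalize CliffordAlgebra.ι Q (e 0) = a at *
    generalize CliffordAlgebra.ι Q (e 1) = b at *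
    generalize CliffordAlgebra.ι Q (e 2) = c at *
    calc b * c * (a * b) = b * (c * a) * b := by noncomm_ring
      _ = -((b * a) * (c * b)) := by rw [h20]; noncomm_ring
      _ = -(a * (b * b) * c) := by rw [h10, h21]; noncomm_ring
      _ = c * a := by rw [h1, mul_one, h20]
  have p10 : E₁ Q * E₀ Q = E₂ Q := by
    rw [← p02, mul_assoc, p20, mul_neg, p01, neg_neg]
  have hs := Real.sin_sq_add_cos_sq α
  rw [Real.cos_two_mul', Real.sin_two_mul]
  simp only [add_mul, mul_add, mul_sub, smul_mul_assoc, mul_smul_comm, one_mul, mul_one,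
    p00, p01, p02, p10, p20, smul_neg, neg_mul, mul_neg]
  have key : E₀ Q = (Real.sin α ^ 2 + Real.cos α ^ 2) • E₀ Q := by rw [hs, one_smul]
  conv_rhs => rw [key]
  module
end
end

section
/- The even subalgebra of the projective geometric algebra of euclidean 3-space is isomorphic to the dual quaternions: there exists an ℝ-algebra isomorphism between the even subalgebra CliffordAlgebra.even Q₃ of Cl(3,0,1) and DualNumber (Quaternion ℝ) (the dual quaternions ℍ[ε], ε² = 0). -/
set_option linter.unusedSimpArgs false

/-- Quaternion from its components. -/
def pgaQ (a b c d : ℝ) : Quaternion ℝ := ⟨a, b, c, d⟩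

@[simp]
theorem pgaQ_re (a b c d : ℝ) : (pgaQ a b c d).re = a := rfl

@[simp]
theorem pgaQ_imI (a b c d : ℝ) : (pgaQ a b c d).imI = b := rfl

@[simp]
theorem pgaQ_imJ (a b c d : ℝ) : (pgaQ a b c d).imJ = c := rfl

@[simp]
theorem pgaQ_imK (a b c d : ℝ) : (pgaQ a b c d).imK = d := rfl

/-- Dual quaternion from its components. -/
def pgaD (a b : Quaternion ℝ) : DualNumber (Quaternion ℝ) := (a, b)

@[simp]
theorem pgaD_fst (a b : Quaternion ℝ) : (pgaD a b).fst = a := rfl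

@[simp]
theorem pgaD_snd (a b : Quaternion ℝ) : (pgaD a b).snd = b := rfl

theorem pga_algebraMap (r : ℝ) : algebraMap ℝ (DualNumber (Quaternion ℝ)) r =
    pgaD (pgaQ r 0 0 0) (pgaQ 0 0 0 0) := rfl

/-- `c ↦ c₁ i + c₂ j + c₃ k + c₀ ε` -/
noncomputable def pgaPhi : (Fin 4 → ℝ) →ₗ[ℝ] DualNumber (Quaternion ℝ) where
  toFun c := pgaD (pgaQ (0) (c 1) (c 2) (c 3)) (pgaQ (c 0) 0 0 0)
  map_add' x y := by
    ext <;> simp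
  map_smul' r x := by
    ext <;> simp

/-- `c ↦ -(c₁ i + c₂ j + c₃ k) + c₀ ε` -/
noncomputable def pgaPsi : (Fin 4 → ℝ) →ₗ[ℝ] DualNumber (Quaternion ℝ) where
  toFun c := pgaD (pgaQ (0) (-c 1) (-c 2) (-c 3)) (pgaQ (c 0) 0 0 0)
  map_add' x y := by
    ext <;> simp <;> ring
  map_smul' r x := by
    ext <;> simp

theorem pgaPhi_apply (c : Fin 4 → ℝ) : pgaPhi c =
    pgaD (pgaQ (0) (c 1) (c 2) (c 3)) (pgaQ (c 0) 0 0 0) := rfl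

theorem pgaPsi_apply (c : Fin 4 → ℝ) : pgaPsi c =
    pgaD (pgaQ (0) (-c 1) (-c 2) (-c 3)) (pgaQ (c 0) 0 0 0) := rfl

theorem pgaPhi_mul_pgaPsi (c : Fin 4 → ℝ) : pgaPhi c * pgaPsi c =
    algebraMap ℝ _ ((c 1) ^ 2 + (c 2) ^ 2 + (c 3) ^ 2) := by
  rw [pgaPhi_apply, pgaPsi_apply, pga_algebraMap]
  ext <;> simp <;> ring

theorem pgaPsi_mul_pgaPhi (c : Fin 4 → ℝ) : pgaPsi c * pgaPhi c =
    algebraMap ℝ _ ((c 1) ^ 2 + (c 2) ^ 2 + (c 3) ^ 2) := by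
  rw [pgaPhi_apply, pgaPsi_apply, pga_algebraMap]
  ext <;> simp <;> ring

section
open CliffordAlgebra
variable (Q₃ : QuadraticForm ℝ (Fin 4 → ℝ))
    (hQ : ∀ c : Fin 4 → ℝ, Q₃ c = (c 1) ^ 2 + (c 2) ^ 2 + (c 3) ^ 2)

/-- The forward map. -/
noncomputable def pgaFwd : even Q₃ →ₐ[ℝ] DualNumber (Quaternion ℝ) :=
  even.lift Q₃
    { bilin := (Algebra.lmul ℝ (DualNumber (Quaternion ℝ))).toLinearMap.compl₁₂ pgaPhi pgaPsi
      contract := fun m => by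
        rw [hQ]; exact pgaPhi_mul_pgaPsi m
      contract_mid := fun a b c => by
        rw [hQ]
        change pgaPhi a * pgaPsi b * (pgaPhi b * pgaPsi c) = _ • (pgaPhi a * pgaPsi c)
        rw [mul_assoc, ← mul_assoc (pgaPsi b), pgaPsi_mul_pgaPhi, Algebra.smul_def,
          Algebra.left_comm] }

theorem pgaFwd_ι (x y : Fin 4 → ℝ) :
    pgaFwd Q₃ hQ ((even.ι Q₃).bilin x y) = pgaPhi x * pgaPsi y :=
  even.lift_ι Q₃ _ x y

/-- basis vectors -/
noncomputable def pgaE (i : Fin 4) : CliffordAlgebra Q₃ := ι Q₃ (Pi.single i 1)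

theorem pga_ι (x : Fin 4 → ℝ) : ι Q₃ x =
    x 0 • pgaE Q₃ 0 + x 1 • pgaE Q₃ 1 + x 2 • pgaE Q₃ 2 + x 3 • pgaE Q₃ 3 := by
  simp only [pgaE, ← map_smul, ← map_add]
  congr 1
  ext i
  fin_cases i <;> simp

include hQ in
theorem pgaE_sq (i : Fin 4) : pgaE Q₃ i * pgaE Q₃ i = if i = 0 then 0 else 1 := by
  rw [pgaE, ι_sq_scalar, hQ]
  fin_cases i <;> simp

include hQ in
theorem pgaE_swap (i j : Fin 4) (h : i < j) :
    pgaE Q₃ j * pgaE Q₃ i = -(pgaE Q₃ i * pgaE Q₃ j) := by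
  rw [eq_neg_iff_add_eq_zero, pgaE, pgaE, ι_mul_ι_add_swap, QuadraticMap.polar, hQ, hQ, hQ]
  fin_cases i <;> fin_cases j <;> simp at h ⊢

/-- products of two basis vectors in the even subalgebra -/
noncomputable def pgaB (i j : Fin 4) : even Q₃ :=
  (even.ι Q₃).bilin (Pi.single i 1) (Pi.single j 1)

theorem pgaB_coe (i j : Fin 4) : (pgaB Q₃ i j : CliffordAlgebra Q₃) = pgaE Q₃ i * pgaE Q₃ j := rfl

include hQ in
theorem pga_rels :
    (∀ i, i ≠ 0 → pgaE Q₃ i * pgaE Q₃ i = 1) ∧ pgaE Q₃ 0 * pgaE Q₃ 0 = 0 ∧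
    (∀ i x, i ≠ 0 → pgaE Q₃ i * (pgaE Q₃ i * x) = x) ∧ (∀ x, pgaE Q₃ 0 * (pgaE Q₃ 0 * x) = 0) ∧
    (∀ i j, i < j → pgaE Q₃ j * pgaE Q₃ i = -(pgaE Q₃ i * pgaE Q₃ j)) ∧
    (∀ i j x, i < j → pgaE Q₃ j * (pgaE Q₃ i * x) = -(pgaE Q₃ i * (pgaE Q₃ j * x))) := by
  refine ⟨fun i h => by simp [pgaE_sq Q₃ hQ, h], by simp [pgaE_sq Q₃ hQ],
    fun i x h => by simp [← mul_assoc, pgaE_sq Q₃ hQ, h],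
    fun x => by simp [← mul_assoc, pgaE_sq Q₃ hQ], pgaE_swap Q₃ hQ, fun i j x h => ?_⟩
  rw [← mul_assoc, pgaE_swap Q₃ hQ i j h, neg_mul, mul_assoc]

/-- quaternion basis -/
noncomputable def pgaBasis : QuaternionAlgebra.Basis (even Q₃) (-1 : ℝ) 0 (-1) where
  i := pgaB Q₃ 3 2
  j := pgaB Q₃ 1 3
  k := pgaB Q₃ 2 1
  i_mul_i := by
    obtain ⟨h1, h2, h3, h4, h5, h6⟩ := pga_rels Q₃ hQ
    apply Subtype.ext
    simp [pgaB_coe, mul_assoc, h1, h2, h3, h4, h5, h6]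
  j_mul_j := by
    obtain ⟨h1, h2, h3, h4, h5, h6⟩ := pga_rels Q₃ hQ
    apply Subtype.ext
    simp [pgaB_coe, mul_assoc, h1, h2, h3, h4, h5, h6]
  i_mul_j := by
    obtain ⟨h1, h2, h3, h4, h5, h6⟩ := pga_rels Q₃ hQ
    apply Subtype.ext
    simp [pgaB_coe, mul_assoc, h1, h2, h3, h4, h5, h6]
  j_mul_i := by
    obtain ⟨h1, h2, h3, h4, h5, h6⟩ := pga_rels Q₃ hQ
    apply Subtype.ext
    simp [pgaB_coe, mul_assoc, h1, h2, h3, h4, h5, h6]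

/-- the dual unit -/
noncomputable def pgaEps : even Q₃ := -(pgaB Q₃ 0 1 * pgaB Q₃ 2 3)

/-- quaternions to the even algebra -/
noncomputable def pgaQuat : Quaternion ℝ →ₐ[ℝ] even Q₃ := (pgaBasis Q₃ hQ).liftHom

theorem pgaQuat_apply (q : Quaternion ℝ) : pgaQuat Q₃ hQ q =
    algebraMap ℝ _ q.re + q.imI • pgaB Q₃ 3 2 + q.imJ • pgaB Q₃ 1 3 + q.imK • pgaB Q₃ 2 1 := rfl

/-- The inverse map. -/
noncomputable def pgaInv : DualNumber (Quaternion ℝ) →ₐ[ℝ] even Q₃ :=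
  DualNumber.lift ⟨(pgaQuat Q₃ hQ, pgaEps Q₃), by
    obtain ⟨h1, h2, h3, h4, h5, h6⟩ := pga_rels Q₃ hQ
    apply Subtype.ext
    simp [pgaEps, pgaB_coe, mul_assoc, h1, h2, h3, h4, h5, h6], fun q => by
    obtain ⟨h1, h2, h3, h4, h5, h6⟩ := pga_rels Q₃ hQ
    apply Subtype.ext
    simp [pgaQuat_apply, pgaEps, pgaB_coe, mul_assoc, h1, h2, h3, h4, h5, h6, mul_add, add_mul,
      Algebra.algebraMap_eq_smul_one]
    abel⟩

theorem pgaInv_apply (d : DualNumber (Quaternion ℝ)) : pgaInv Q₃ hQ d =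
    pgaQuat Q₃ hQ d.fst + pgaQuat Q₃ hQ d.snd * pgaEps Q₃ :=
  DualNumber.lift_apply_apply _ _

theorem pgaInv_comp_pgaFwd : (pgaInv Q₃ hQ).comp (pgaFwd Q₃ hQ) = AlgHom.id ℝ _ := by
  refine even.algHom_ext Q₃ (EvenHom.ext (LinearMap.ext fun x => LinearMap.ext fun y =>
    Subtype.ext ?_))
  change ((pgaInv Q₃ hQ (pgaFwd Q₃ hQ ((even.ι Q₃).bilin x y)) : even Q₃) : CliffordAlgebra Q₃) =
    ι Q₃ x * ι Q₃ y
  obtain ⟨h1, h2, h3, h4, h5, h6⟩ := pga_rels Q₃ hQ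
  rw [pgaFwd_ι, pgaInv_apply, pga_ι, pga_ι, pgaPhi_apply, pgaPsi_apply]
  simp [pgaQuat_apply, pgaEps, pgaB_coe, mul_assoc, h1, h2, h3, h4, h5, h6, mul_add, add_mul,
      Algebra.algebraMap_eq_smul_one]
  module

theorem pgaFwd_pgaB (i j : Fin 4) : pgaFwd Q₃ hQ (pgaB Q₃ i j) =
    pgaPhi (Pi.single i 1) * pgaPsi (Pi.single j 1) := pgaFwd_ι Q₃ hQ _ _

theorem pgaFwd_comp_pgaInv : (pgaFwd Q₃ hQ).comp (pgaInv Q₃ hQ) = AlgHom.id ℝ _ := by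
  refine AlgHom.ext fun d => ?_
  change pgaFwd Q₃ hQ (pgaInv Q₃ hQ d) = d
  rw [pgaInv_apply, pgaQuat_apply, pgaQuat_apply, pgaEps]
  simp only [map_add, map_mul, map_neg, map_smul, pgaFwd_pgaB, AlgHom.commutes, pgaPhi_apply,
    pgaPsi_apply, pga_algebraMap]
  ext <;> simp

end

theorem even_subalgebra_iso_dual_quaternions
    (Q₃ : QuadraticForm ℝ (Fin 4 → ℝ))
    (hQ : ∀ c : Fin 4 → ℝ, Q₃ c = (c 1) ^ 2 + (c 2) ^ 2 + (c 3) ^ 2) :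
    Nonempty (CliffordAlgebra.even Q₃ ≃ₐ[ℝ] DualNumber (Quaternion ℝ)) := by
  exact ⟨AlgEquiv.ofAlgHom (pgaFwd Q₃ hQ) (pgaInv Q₃ hQ) (pgaFwd_comp_pgaInv Q₃ hQ)
    (pgaInv_comp_pgaFwd Q₃ hQ)⟩
end
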